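/- arXiv:2206.13226 — 5 statements merged into one kernel-verified Lean document; each statement's English description precedes it below -/
import Mathlib

section
/- Let 0 < a < b be real numbers and n a positive integer. For every s ≥ b·e², one has ∫_a^b L_n(t/s) · (1/t) dt ≤ (1/√π)·((b/s)^{n/2} − (a/s)^{n/2}). -/
/-- The Mellin-Gauss-Weierstrass kernel
`L_n(t) = (n/(2√π))·exp(−(n²/4)·(ln t)²)`. -/
noncomputable def mgwKernel (n : ℕ) (t : ℝ) : ℝ :=
  ((n : ℝ) / (2 * Real.sqrt Real.pi)) * Real.exp (-((n : ℝ) ^ 2 / 4) * (Real.log t) ^ 2)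

/-- On `(0, e⁻²]` the kernel is dominated by a power function. -/
lemma mgwKernel_le_rpow {n : ℕ} (hn : 0 < n) {x : ℝ} (hx : 0 < x) (hx' : Real.log x ≤ -2) :
    mgwKernel n x ≤ ((n : ℝ) / (2 * Real.sqrt Real.pi)) * x ^ ((n : ℝ) / 2) := by
  have hn' : (1 : ℝ) ≤ n := by exact_mod_cast hn
  unfold mgwKernel
  rw [Real.rpow_def_of_pos hx]
  have h : 0 ≤ (n : ℝ) * (-Real.log x) * (n * (-Real.log x) - 2) := by
    apply mul_nonneg <;> nlinarith
  refine mul_le_mul_of_nonneg_left (Real.exp_le_exp.mpr ?_) (by positivity)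
  linarith

lemma continuousOn_mgwKernel (n : ℕ) : ContinuousOn (mgwKernel n) (Set.Ioi 0) := by
  have hlog : ContinuousOn Real.log (Set.Ioi 0) :=
    Real.continuousOn_log.mono fun x hx => ne_of_gt hx
  unfold mgwKernel
  fun_prop

lemma hasDerivAt_div_rpow {s t : ℝ} (hs : 0 < s) (ht : 0 < t) (p : ℝ) :
    HasDerivAt (fun t => (t / s) ^ p) (p * (t / s) ^ p * (1 / t)) t := by
  have hts : 0 < t / s := div_pos ht hs
  refine (((hasDerivAt_id t).div_const s).rpow_const (p := p) (Or.inl hts.ne')).congr_deriv ?_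
  change 1 / s * p * (t / s) ^ (p - 1) = _
  rw [Real.rpow_sub_one hts.ne']
  field_simp

/-- For `0 < a < b`, a positive integer `n` and every `s ≥ b·e²`, one has
`∫_a^b L_n(t/s)·(1/t) dt ≤ (1/√π)·((b/s)^{n/2} − (a/s)^{n/2})`. -/
theorem mgwKernel_bound_right (a b : ℝ) (ha : 0 < a) (hab : a < b)
    (n : ℕ) (hn : 0 < n) (s : ℝ) (hs : b * Real.exp 2 ≤ s) :
    (∫ t in a..b, mgwKernel n (t / s) * (1 / t)) ≤
      (1 / Real.sqrt Real.pi) * ((b / s) ^ ((n : ℝ) / 2) - (a / s) ^ ((n : ℝ) / 2)) := by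
  have hb : 0 < b := ha.trans hab
  have hs0 : 0 < s := lt_of_lt_of_le (by positivity) hs
  have hpos : ∀ t ∈ Set.uIcc a b, 0 < t := by
    rw [Set.uIcc_of_le hab.le]
    exact fun t ht => ha.trans_le ht.1
  have hinv : ContinuousOn (fun t : ℝ => 1 / t) (Set.uIcc a b) :=
    continuousOn_const.div continuousOn_id fun t ht => (hpos t ht).ne'
  have hdiv : ContinuousOn (fun t : ℝ => t / s) (Set.uIcc a b) := by fun_prop
  have hker : IntervalIntegrable (fun t => mgwKernel n (t / s) * (1 / t))
      MeasureTheory.volume a b :=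
    (((continuousOn_mgwKernel n).comp hdiv fun t ht => div_pos (hpos t ht) hs0).mul
      hinv).intervalIntegrable
  have hpow : IntervalIntegrable (fun t => (n : ℝ) / 2 * (t / s) ^ ((n : ℝ) / 2) * (1 / t))
      MeasureTheory.volume a b :=
    ((continuousOn_const.mul (hdiv.rpow_const fun t _ => Or.inr (by positivity))).mul
      hinv).intervalIntegrable
  rw [← intervalIntegral.integral_eq_sub_of_hasDerivAt
      (fun t ht => hasDerivAt_div_rpow hs0 (hpos t ht) _) hpow,
    ← intervalIntegral.integral_const_mul]
  refine intervalIntegral.integral_mono_on hab.le hker (hpow.const_mul _) fun t ht => ?_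
  have ht0 : 0 < t := ha.trans_le ht.1
  have hlog : Real.log (t / s) ≤ -2 := by
    rw [Real.log_le_iff_le_exp (div_pos ht0 hs0), div_le_iff₀ hs0]
    calc t ≤ b := ht.2
      _ = Real.exp (-2) * (b * Real.exp 2) := by
        rw [mul_left_comm, ← Real.exp_add]; simp
      _ ≤ Real.exp (-2) * s := by gcongr
  calc mgwKernel n (t / s) * (1 / t)
      ≤ (n : ℝ) / (2 * Real.sqrt Real.pi) * (t / s) ^ ((n : ℝ) / 2) * (1 / t) := by
        gcongr
        exact mgwKernel_le_rpow hn (div_pos ht0 hs0) hlog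
    _ = 1 / Real.sqrt Real.pi * ((n : ℝ) / 2 * (t / s) ^ ((n : ℝ) / 2) * (1 / t)) := by
        field_simp
end

section
/- Let 0 < a < b be real numbers and n a positive integer. For every s with 0 < s ≤ a·e^{−2}, one has ∫_a^b L_n(t/s) · (1/t) dt ≤ (1/√π)·((s/a)^{n/2} − (s/b)^{n/2}). -/
theorem continuousOn_mgwKernel_div_mul_inv (n : ℕ) {s : ℝ} (hs : 0 < s) :
    ContinuousOn (fun t => mgwKernel n (t / s) * (1 / t)) (Set.Ioi 0) := by
  unfold mgwKernel
  have hlog : ContinuousOn (fun t => Real.log (t / s)) (Set.Ioi 0) :=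
    (continuousOn_id.div_const s).log fun t ht => (div_pos ht hs).ne'
  have hinv : ContinuousOn (fun t : ℝ => 1 / t) (Set.Ioi 0) :=
    continuousOn_const.div continuousOn_id fun t ht => (Set.mem_Ioi.1 ht).ne'
  exact (continuousOn_const.mul (continuousOn_const.mul (hlog.pow 2)).rexp).mul hinv

theorem hasDerivAt_neg_div_rpow {s t : ℝ} (hs : 0 < s) (ht : 0 < t) (c : ℝ) :
    HasDerivAt (fun x => -(s / x) ^ c) (c * (s / t) ^ c * (1 / t)) t := by
  have hdiv : HasDerivAt (fun x : ℝ => s / x) (-s / t ^ 2) t := by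
    simpa using (hasDerivAt_const t s).fun_div (hasDerivAt_id' t) ht.ne'
  have hst : s / t ≠ 0 := (div_pos hs ht).ne'
  refine (hdiv.rpow_const (p := c) (Or.inl hst)).fun_neg.congr_deriv ?_
  rw [Real.rpow_sub_one hst]
  field_simp

theorem mgwKernel_le {n : ℕ} {x : ℝ} (hx : 0 < x) (hnx : 2 ≤ n * Real.log x) :
    mgwKernel n x ≤ (1 / Real.sqrt Real.pi) * ((n : ℝ) / 2 * x⁻¹ ^ ((n : ℝ) / 2)) := by
  have hexp : Real.exp (-((n : ℝ) ^ 2 / 4) * (Real.log x) ^ 2) ≤ x⁻¹ ^ ((n : ℝ) / 2) := by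
    rw [Real.rpow_def_of_pos (inv_pos.2 hx), Real.log_inv]
    apply Real.exp_le_exp.2
    nlinarith
  calc mgwKernel n x ≤ (n : ℝ) / (2 * Real.sqrt Real.pi) * x⁻¹ ^ ((n : ℝ) / 2) := by
        unfold mgwKernel
        gcongr
    _ = _ := by field_simp

/-- For `0 < a < b`, a positive integer `n` and every `s` with `0 < s ≤ a·e^{−2}`,
one has `∫_a^b L_n(t/s)·(1/t) dt ≤ (1/√π)·((s/a)^{n/2} − (s/b)^{n/2})`. -/
theorem mgwKernel_bound_left (a b : ℝ) (ha : 0 < a) (hab : a < b)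
    (n : ℕ) (hn : 0 < n) (s : ℝ) (hs0 : 0 < s) (hs : s ≤ a * Real.exp (-2)) :
    (∫ t in a..b, mgwKernel n (t / s) * (1 / t)) ≤
      (1 / Real.sqrt Real.pi) * ((s / a) ^ ((n : ℝ) / 2) - (s / b) ^ ((n : ℝ) / 2)) := by
  have hpos : Set.uIcc a b ⊆ Set.Ioi 0 := by
    rw [Set.uIcc_of_le hab.le]
    exact fun t ht => ha.trans_le ht.1
  have hcont : ContinuousOn (fun t => (n : ℝ) / 2 * (s / t) ^ ((n : ℝ) / 2) * (1 / t))
      (Set.uIcc a b) := by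
    have hne : ∀ t ∈ Set.uIcc a b, t ≠ 0 := fun t ht => (Set.mem_Ioi.1 (hpos ht)).ne'
    exact (continuousOn_const.mul ((continuousOn_const.div continuousOn_id hne).rpow_const
      fun t ht => Or.inr (by positivity))).mul (continuousOn_const.div continuousOn_id hne)
  have hint := intervalIntegral.integral_eq_sub_of_hasDerivAt
    (fun t ht => hasDerivAt_neg_div_rpow hs0 (hpos ht) ((n : ℝ) / 2)) hcont.intervalIntegrable
  calc (∫ t in a..b, mgwKernel n (t / s) * (1 / t))
      ≤ ∫ t in a..b, (1 / Real.sqrt Real.pi) *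
          ((n : ℝ) / 2 * (s / t) ^ ((n : ℝ) / 2) * (1 / t)) := by
        apply intervalIntegral.integral_mono_on hab.le
          ((continuousOn_mgwKernel_div_mul_inv n hs0).mono hpos).intervalIntegrable
          (hcont.intervalIntegrable.const_mul _)
        intro t ht
        have ht0 : 0 < t := ha.trans_le ht.1
        have hlog : 2 ≤ Real.log (t / s) := by
          rw [Real.le_log_iff_exp_le (div_pos ht0 hs0), le_div_iff₀ hs0]
          calc Real.exp 2 * s ≤ Real.exp 2 * (a * Real.exp (-2)) := by gcongr
            _ = a := by rw [Real.exp_neg]; field_simp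
            _ ≤ t := ht.1
        have hn1 : (1 : ℝ) ≤ n := by exact_mod_cast hn
        have hle := mgwKernel_le (n := n) (div_pos ht0 hs0) (by nlinarith)
        rw [inv_div] at hle
        rw [← mul_assoc]
        gcongr
    _ = _ := by
        rw [intervalIntegral.integral_const_mul, hint]
        ring
end

section
/- Let δ > 1 be real and let n be a positive integer with n·ln δ ≥ 2. Then the tail integral of the Mellin-Gauss-Weierstrass kernel satisfies ∫_{(0,∞) \ [1/δ, δ]} L_n(t) · (1/t) dt ≤ (2/√π)·exp(−(n·ln δ)/2). -/
open MeasureTheory Set in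
/-- The function `t ^ (-a - 1)` is integrable on `(δ, ∞)`, with integral `exp (-a log δ) / a`. -/
theorem integrableOn_and_integral_rpow_Ioi {a δ : ℝ} (ha : 0 < a) (hδ : 0 < δ) :
    IntegrableOn (fun t : ℝ => t ^ (-a - 1)) (Ioi δ) ∧
      ∫ t in Ioi δ, t ^ (-a - 1) = Real.exp (-(a * Real.log δ)) / a := by
  refine ⟨integrableOn_Ioi_rpow_of_lt (by linarith) hδ, ?_⟩
  rw [integral_Ioi_rpow_of_lt (by linarith) hδ, sub_add_cancel, Real.rpow_def_of_pos hδ,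
    neg_div_neg_eq]
  ring_nf

open MeasureTheory Set in
/-- The function `t ^ (a - 1)` is integrable on `(0, 1 / δ)`, with integral `exp (-a log δ) / a`. -/
theorem integrableOn_and_integral_rpow_Ioo {a δ : ℝ} (ha : 0 < a) (hδ : 0 < δ) :
    IntegrableOn (fun t : ℝ => t ^ (a - 1)) (Ioo 0 (1 / δ)) ∧
      ∫ t in Ioo 0 (1 / δ), t ^ (a - 1) = Real.exp (-(a * Real.log δ)) / a := by
  have hδ' : 0 < 1 / δ := by positivity
  constructor
  · rw [← integrableOn_Ioc_iff_integrableOn_Ioo,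
      ← intervalIntegrable_iff_integrableOn_Ioc_of_le hδ'.le]
    exact intervalIntegral.intervalIntegrable_rpow' (by linarith)
  · rw [← integral_Ioc_eq_integral_Ioo, ← intervalIntegral.integral_of_le hδ'.le,
      integral_rpow (Or.inl (by linarith)), sub_add_cancel, Real.zero_rpow ha.ne',
      Real.rpow_def_of_pos hδ', one_div, Real.log_inv]
    ring_nf

theorem mgwKernel_nonneg (n : ℕ) (t : ℝ) : 0 ≤ mgwKernel n t := by
  unfold mgwKernel
  positivity

/-- If `x = ± log t` and `n * x ≥ 2`, the Gaussian factor is dominated by an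
exponential in `x`. -/
theorem mgwKernel_mul_one_div_le {n : ℕ} {t x : ℝ} (ht : 0 < t) (hx : x ^ 2 = Real.log t ^ 2)
    (hnx : 2 ≤ (n : ℝ) * x) :
    mgwKernel n t * (1 / t) ≤
      (n : ℝ) / (2 * Real.sqrt Real.pi) * Real.exp (-((n : ℝ) / 2 * x) - Real.log t) := by
  rw [mgwKernel, Real.exp_sub, Real.exp_log ht, ← hx, mul_assoc, mul_one_div]
  gcongr
  nlinarith

open MeasureTheory Set in
/-- For `δ > 1` and a positive integer `n` with `n·ln δ ≥ 2`, the tail integral of the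
Mellin-Gauss-Weierstrass kernel satisfies
`∫_{(0,∞) \ [1/δ, δ]} L_n(t)·(1/t) dt ≤ (2/√π)·exp(−(n·ln δ)/2)`. -/
theorem mgwKernel_tail_bound (δ : ℝ) (hδ : 1 < δ) (n : ℕ) (hn : 0 < n)
    (hnδ : 2 ≤ (n : ℝ) * Real.log δ) :
    (∫ t in Set.Ioi (0 : ℝ) \ Set.Icc (1 / δ) δ, mgwKernel n t * (1 / t)) ≤
      (2 / Real.sqrt Real.pi) * Real.exp (-((n : ℝ) * Real.log δ) / 2) := by
  have hδ0 : 0 < δ := by linarith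
  have hn0 : (0 : ℝ) < n := by exact_mod_cast hn
  have hinv : 1 / δ < 1 := by rw [div_lt_one hδ0]; exact hδ
  have hset : Ioi (0 : ℝ) \ Icc (1 / δ) δ = Ioo 0 (1 / δ) ∪ Ioi δ := by
    ext t
    simp only [mem_sdiff, mem_Ioi, mem_Icc, mem_union, mem_Ioo, not_and_or, not_le]
    grind
  have hdisj : Disjoint (Ioo 0 (1 / δ)) (Ioi δ) := by
    rw [disjoint_left]
    intro t h1 h2
    simp only [mem_Ioo, mem_Ioi] at h1 h2
    linarith
  set C : ℝ := (n : ℝ) / (2 * Real.sqrt Real.pi) with hC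
  set f : ℝ → ℝ := fun t => mgwKernel n t * (1 / t)
  have hf_nonneg : ∀ t, 0 < t → 0 ≤ f t := fun t ht =>
    mul_nonneg (mgwKernel_nonneg n t) (by positivity)
  have hf_meas : Measurable f := by
    unfold f mgwKernel
    fun_prop
  obtain ⟨hi1, he1⟩ := integrableOn_and_integral_rpow_Ioo (half_pos hn0) hδ0
  obtain ⟨hi2, he2⟩ := integrableOn_and_integral_rpow_Ioi (half_pos hn0) hδ0
  have hle1 : ∀ t ∈ Ioo 0 (1 / δ), f t ≤ C * t ^ ((n : ℝ) / 2 - 1) := by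
    intro t ht
    have hlog : Real.log t < -Real.log δ := by
      rw [← Real.log_inv, ← one_div]
      exact Real.log_lt_log ht.1 ht.2
    refine (mgwKernel_mul_one_div_le (x := -Real.log t) ht.1 (neg_sq _) (by nlinarith)).trans_eq ?_
    rw [hC, Real.rpow_def_of_pos ht.1]
    ring_nf
  have hle2 : ∀ t ∈ Ioi δ, f t ≤ C * t ^ (-((n : ℝ) / 2) - 1) := by
    intro t ht
    have ht0 : 0 < t := hδ0.trans ht
    have hlog : Real.log δ < Real.log t := Real.log_lt_log hδ0 ht
    refine (mgwKernel_mul_one_div_le (x := Real.log t) ht0 rfl (by nlinarith)).trans_eq ?_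
    rw [hC, Real.rpow_def_of_pos ht0]
    ring_nf
  have hf1 : IntegrableOn f (Ioo 0 (1 / δ)) :=
    (hi1.const_mul C).mono' hf_meas.aestronglyMeasurable <|
      (ae_restrict_mem measurableSet_Ioo).mono fun t ht => by
        rw [Real.norm_of_nonneg (hf_nonneg t ht.1)]
        exact hle1 t ht
  have hf2 : IntegrableOn f (Ioi δ) :=
    (hi2.const_mul C).mono' hf_meas.aestronglyMeasurable <|
      (ae_restrict_mem measurableSet_Ioi).mono fun t ht => by
        rw [Real.norm_of_nonneg (hf_nonneg t (hδ0.trans ht))]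
        exact hle2 t ht
  rw [hset, setIntegral_union hdisj measurableSet_Ioi hf1 hf2]
  refine (add_le_add (setIntegral_mono_on hf1 (hi1.const_mul C) measurableSet_Ioo hle1)
    (setIntegral_mono_on hf2 (hi2.const_mul C) measurableSet_Ioi hle2)).trans_eq ?_
  rw [integral_const_mul, integral_const_mul, he1, he2, hC,
    show -((n : ℝ) * Real.log δ) / 2 = -((n : ℝ) / 2 * Real.log δ) by ring]
  field_simp
  ring
end

section
/- Let p ≥ 2 be an integer, δ > 1 a real number, and n a positive integer. Then the tail integral of the Mellin-Poisson-Cauchy kernel satisfies ∫_{(0,∞) \ [1/δ, δ]} L_{n,p}(t) · (1/t) dt ≤ C_p · (π − 2·arctan(n·ln δ)). -/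
/-- The constant `C_p = 2^{p−1}·(p−1)! / (π·(2p−3)!!)` of the
Mellin-Poisson-Cauchy kernel. -/
noncomputable def mpcConst (p : ℕ) : ℝ :=
  (2 : ℝ) ^ (p - 1) * (Nat.factorial (p - 1)) / (Real.pi * (Nat.doubleFactorial (2 * p - 3)))

/-- The Mellin-Poisson-Cauchy kernel of order `p`:
`L_{n,p}(t) = C_p · n/(1 + n²·(ln t)²)^p`. -/
noncomputable def mpcKernel (p n : ℕ) (t : ℝ) : ℝ :=
  mpcConst p * (n : ℝ) / (1 + (n : ℝ) ^ 2 * (Real.log t) ^ 2) ^ p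

open Set MeasureTheory in
/-- The Cauchy density has mass `π - 2 arctan a` outside `[-a, a]`. -/
theorem integral_inv_one_add_sq_tails {a : ℝ} (ha : 0 ≤ a) :
    ∫ x in Iic (-a) ∪ Ioi a, (1 + x ^ 2)⁻¹ = Real.pi - 2 * Real.arctan a := by
  have hdisj : Disjoint (Iic (-a)) (Ioi a) :=
    disjoint_left.2 fun x hx hx' => by
      simp only [mem_Iic, mem_Ioi] at hx hx'
      linarith
  rw [setIntegral_union hdisj measurableSet_Ioi integrable_inv_one_add_sq.integrableOn
    integrable_inv_one_add_sq.integrableOn, integral_Iic_inv_one_add_sq,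
    integral_Ioi_inv_one_add_sq, Real.arctan_neg]
  ring

theorem mpcConst_nonneg (p : ℕ) : 0 ≤ mpcConst p := by
  unfold mpcConst
  positivity

/-- For `p ≠ 0`, the kernel is dominated by the one with exponent `1`. -/
theorem mpcKernel_mul_le {p : ℕ} (hp : p ≠ 0) (n : ℕ) {t : ℝ} (ht : 0 < t) :
    mpcKernel p n t * (1 / t) ≤
      mpcConst p * (|(n : ℝ) / t| • (1 + ((n : ℝ) * Real.log t) ^ 2)⁻¹) := by
  have hC := mpcConst_nonneg p
  have hbase : 1 ≤ 1 + (n : ℝ) ^ 2 * Real.log t ^ 2 := le_add_of_nonneg_right (by positivity)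
  rw [abs_of_nonneg (by positivity), smul_eq_mul, mul_pow]
  calc mpcKernel p n t * (1 / t)
      ≤ mpcConst p * n / (1 + (n : ℝ) ^ 2 * Real.log t ^ 2) * (1 / t) := by
        unfold mpcKernel
        gcongr
        exact le_self_pow₀ hbase hp
    _ = _ := by ring

open Set MeasureTheory in
/-- For every integer `p ≥ 2`, real `δ > 1` and positive integer `n`, the tail integral
of the Mellin-Poisson-Cauchy kernel satisfies
`∫_{(0,∞) \ [1/δ, δ]} L_{n,p}(t)·(1/t) dt ≤ C_p·(π − 2·arctan(n·ln δ))`. -/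
theorem mpcKernel_tail_bound (p : ℕ) (hp : 2 ≤ p) (δ : ℝ) (hδ : 1 < δ)
    (n : ℕ) (hn : 0 < n) :
    (∫ t in Set.Ioi (0 : ℝ) \ Set.Icc (1 / δ) δ, mpcKernel p n t * (1 / t)) ≤
      mpcConst p * (Real.pi - 2 * Real.arctan ((n : ℝ) * Real.log δ)) := by
  have hC := mpcConst_nonneg p
  have hn' : (0 : ℝ) < n := by exact_mod_cast hn
  have hδ0 : 0 < δ := one_pos.trans hδ
  have hlog := Real.log_pos hδ
  set S : Set ℝ := Ioi 0 \ Icc (1 / δ) δ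
  set f : ℝ → ℝ := fun t => n * Real.log t
  have hS : MeasurableSet S := measurableSet_Ioi.diff measurableSet_Icc
  have hpos : ∀ t ∈ S, 0 < t := fun t ht => ht.1
  have hderiv : ∀ t ∈ S, HasDerivWithinAt f (n / t) S t := fun t ht =>
    ((Real.hasDerivAt_log (hpos t ht).ne').const_mul (n : ℝ)).hasDerivWithinAt
  have hinj : InjOn f S := fun x hx y hy hxy =>
    Real.log_injOn_pos (hpos x hx) (hpos y hy) (mul_left_cancel₀ hn'.ne' hxy)
  have himage : f '' S ⊆ Iic (-(n * Real.log δ)) ∪ Ioi (n * Real.log δ) := by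
    rintro _ ⟨t, ht, rfl⟩
    rcases lt_or_ge δ t with h | h
    · exact Or.inr (mul_lt_mul_of_pos_left (Real.log_lt_log hδ0 h) hn')
    · have hlt : t < 1 / δ := lt_of_not_ge fun h' => ht.2 ⟨h', h⟩
      have hle := Real.log_le_log (hpos t ht) hlt.le
      rw [one_div, Real.log_inv] at hle
      left
      rw [mem_Iic, ← mul_neg]
      exact mul_le_mul_of_nonneg_left hle hn'.le
  have hint : IntegrableOn (fun t => |(n : ℝ) / t| • (1 + f t ^ 2)⁻¹) S :=
    (integrableOn_image_iff_integrableOn_abs_deriv_smul hS hderiv hinj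
      fun x => (1 + x ^ 2)⁻¹).1 integrable_inv_one_add_sq.integrableOn
  calc ∫ t in S, mpcKernel p n t * (1 / t)
      ≤ ∫ t in S, mpcConst p * (|(n : ℝ) / t| • (1 + f t ^ 2)⁻¹) := by
        refine integral_mono_of_nonneg ?_ (hint.const_mul _) ?_
        · filter_upwards [ae_restrict_mem hS] with t ht
          have := hpos t ht
          simp only [mpcKernel, Pi.zero_apply]
          positivity
        · filter_upwards [ae_restrict_mem hS] with t ht
          exact mpcKernel_mul_le (by omega) n (hpos t ht)
    _ = mpcConst p * ∫ x in f '' S, (1 + x ^ 2)⁻¹ := by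
        rw [integral_const_mul, integral_image_eq_integral_abs_deriv_smul hS hderiv hinj]
    _ ≤ mpcConst p * ∫ x in Iic (-(n * Real.log δ)) ∪ Ioi (n * Real.log δ), (1 + x ^ 2)⁻¹ := by
        refine mul_le_mul_of_nonneg_left (setIntegral_mono_set
          integrable_inv_one_add_sq.integrableOn ?_ himage.eventuallyLE) hC
        exact Filter.Eventually.of_forall fun x => by
          simp only [Pi.zero_apply]
          positivity
    _ = mpcConst p * (Real.pi - 2 * Real.arctan (n * Real.log δ)) := by
        rw [integral_inv_one_add_sq_tails (by positivity)]
end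

section
/- Let p ≥ 2 be an integer and δ > 1 a real number. Then there exist a positive real constant K (depending on δ and p) and a positive integer n₀ such that for all integers n ≥ n₀, the tail integral satisfies ∫_{(0,∞) \ [1/δ, δ]} L_{n,p}(t) · (1/t) dt ≤ K/n. -/
open MeasureTheory

theorem mpcConst_pos (p : ℕ) : 0 < mpcConst p := by
  unfold mpcConst
  have := Nat.doubleFactorial_pos (2 * p - 3)
  have := Nat.factorial_pos (p - 1)
  positivity

theorem Real.hasDerivAt_neg_inv_log {t : ℝ} (ht : t ≠ 0) (hlog : Real.log t ≠ 0) :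
    HasDerivAt (fun t ↦ -(Real.log t)⁻¹) (1 / (t * Real.log t ^ 2)) t := by
  refine ((Real.hasDerivAt_log ht).fun_inv hlog).fun_neg.congr_deriv ?_
  field_simp

theorem Real.continuousAt_inv_log_zero : ContinuousAt (fun t ↦ (Real.log t)⁻¹) 0 := by
  rw [← continuousWithinAt_compl_self, ContinuousWithinAt]
  simpa [Function.comp_def] using tendsto_inv_atBot_zero.comp Real.tendsto_log_nhdsNE_zero

theorem integrableOn_Ioc_one_div_mul_log_sq {a : ℝ} (ha : a < 1) :
    IntegrableOn (fun t : ℝ ↦ 1 / (t * Real.log t ^ 2)) (Set.Ioc 0 a) := by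
  have hlog : ∀ t, 0 < t → t ≤ a → Real.log t ≠ 0 := fun t h0 h1 ↦
    (Real.log_neg h0 (h1.trans_lt ha)).ne
  refine intervalIntegral.integrableOn_deriv_of_nonneg
    (g := fun t ↦ -(Real.log t)⁻¹) ?_ (fun t ht ↦ ?_) (fun t ht ↦ ?_)
  · intro t ht
    rcases ht.1.eq_or_lt with rfl | h0
    · exact Real.continuousAt_inv_log_zero.neg.continuousWithinAt
    · exact (Real.hasDerivAt_neg_inv_log h0.ne' (hlog t h0 ht.2)).continuousAt.continuousWithinAt
  · exact Real.hasDerivAt_neg_inv_log ht.1.ne' (hlog t ht.1 ht.2.le)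
  · have := ht.1
    positivity

theorem integrableOn_Ioi_one_div_mul_log_sq {b : ℝ} (hb : 1 < b) :
    IntegrableOn (fun t : ℝ ↦ 1 / (t * Real.log t ^ 2)) (Set.Ioi b) := by
  refine integrableOn_Ioi_deriv_of_nonneg' (l := 0)
    (g := fun t ↦ -(Real.log t)⁻¹) (fun t ht ↦ ?_) (fun t ht ↦ ?_) ?_
  · have h1 : 1 < t := hb.trans_le ht
    exact Real.hasDerivAt_neg_inv_log (by positivity) (Real.log_pos h1).ne'
  · have : 0 < t := (zero_lt_one.trans hb).trans ht
    positivity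
  · simpa [Function.comp_def] using (tendsto_inv_atTop_zero.comp Real.tendsto_log_atTop).neg

theorem integrableOn_one_div_mul_log_sq_tail {δ : ℝ} (hδ : 1 < δ) :
    IntegrableOn (fun t : ℝ ↦ 1 / (t * Real.log t ^ 2)) (Set.Ioi 0 \ Set.Icc (1 / δ) δ) := by
  have h1 : 1 / δ < 1 := (div_lt_one (by positivity)).2 hδ
  refine ((integrableOn_Ioc_one_div_mul_log_sq h1).union
    (integrableOn_Ioi_one_div_mul_log_sq hδ)).mono_set fun t ⟨h0, ht⟩ ↦ ?_
  by_cases h : t ≤ 1 / δ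
  · exact Or.inl ⟨h0, h⟩
  · exact Or.inr (not_le.1 fun h' ↦ ht ⟨(not_le.1 h).le, h'⟩)

theorem mpcKernel_nonneg (p n : ℕ) (t : ℝ) : 0 ≤ mpcKernel p n t := by
  have := mpcConst_pos p
  unfold mpcKernel
  positivity

theorem mpcKernel_mul_one_div_le {p n : ℕ} (hp : p ≠ 0) (hn : 0 < n) {t : ℝ} (ht : 0 < t)
    (hlog : Real.log t ≠ 0) :
    mpcKernel p n t * (1 / t) ≤ mpcConst p / n * (1 / (t * Real.log t ^ 2)) := by
  have hC := mpcConst_pos p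
  have hle : (n : ℝ) ^ 2 * Real.log t ^ 2 ≤ (1 + (n : ℝ) ^ 2 * Real.log t ^ 2) ^ p :=
    (le_add_of_nonneg_left zero_le_one).trans
      (le_self_pow₀ (le_add_of_nonneg_right (by positivity)) hp)
  calc mpcKernel p n t * (1 / t)
      ≤ mpcConst p * n / ((n : ℝ) ^ 2 * Real.log t ^ 2) * (1 / t) := by
        unfold mpcKernel
        gcongr
    _ = mpcConst p / n * (1 / (t * Real.log t ^ 2)) := by
        field_simp

/-- For every integer `p ≥ 2` and real `δ > 1`, there exist a constant `K > 0`
(depending on `δ` and `p`) and a positive integer `n₀` such that for all `n ≥ n₀`,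
`∫_{(0,∞) \ [1/δ, δ]} L_{n,p}(t)·(1/t) dt ≤ K/n`. -/
theorem mpcKernel_tail_bound_div_n (p : ℕ) (hp : 2 ≤ p) (δ : ℝ) (hδ : 1 < δ) :
    ∃ K : ℝ, 0 < K ∧ ∃ n₀ : ℕ, 0 < n₀ ∧ ∀ n : ℕ, n₀ ≤ n →
      (∫ t in Set.Ioi (0 : ℝ) \ Set.Icc (1 / δ) δ, mpcKernel p n t * (1 / t)) ≤
        K / (n : ℝ) := by
  set S := Set.Ioi (0 : ℝ) \ Set.Icc (1 / δ) δ
  have hmeas : MeasurableSet S := measurableSet_Ioi.diff measurableSet_Icc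
  have hC := mpcConst_pos p
  have hI : 0 ≤ ∫ t in S, 1 / (t * Real.log t ^ 2) :=
    setIntegral_nonneg hmeas fun t ht ↦ by
      have : 0 < t := ht.1
      positivity
  refine ⟨mpcConst p * ((∫ t in S, 1 / (t * Real.log t ^ 2)) + 1), by positivity, 1, one_pos,
    fun n hn ↦ ?_⟩
  calc ∫ t in S, mpcKernel p n t * (1 / t)
      ≤ ∫ t in S, mpcConst p / n * (1 / (t * Real.log t ^ 2)) := by
        refine integral_mono_of_nonneg ?_
          ((integrableOn_one_div_mul_log_sq_tail hδ).const_mul _) ?_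
        · filter_upwards [ae_restrict_mem hmeas] with t ht
          exact mul_nonneg (mpcKernel_nonneg p n t) (one_div_nonneg.2 (le_of_lt ht.1))
        · filter_upwards [ae_restrict_mem hmeas] with t ht
          have h0 : 0 < t := ht.1
          refine mpcKernel_mul_one_div_le (by lia) hn h0
            (Real.log_ne_zero_of_pos_of_ne_one h0 ?_)
          rintro rfl
          exact ht.2 ⟨((div_lt_one (by positivity)).2 hδ).le, hδ.le⟩
    _ = mpcConst p * (∫ t in S, 1 / (t * Real.log t ^ 2)) / n := by
        rw [integral_const_mul]
        ring
    _ ≤ mpcConst p * ((∫ t in S, 1 / (t * Real.log t ^ 2)) + 1) / n := by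
        gcongr
        linarith
end
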